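/- Let N be a finite abelian network in which every configuration halts (as is the case for every finite, locally irreducible, subcritical abelian network). Then: (i) every configuration is legally related to some stable configuration; and (ii) any two stable configurations that are legally related are equal. Consequently, every equivalence class of configurations under the legal relation contains exactly one stable configuration. -/

import Mathlib

namespace AbelianNetworks

/-- An abelian network on the alphabet `A` with state set `Q`: commuting transition maps
`t a : Q → Q` and message-passing vectors `msg a : Q → ℕ^A` satisfying the abelian axioms. -/
structure Network (A Q : Type*) where
  t : A → Q → Q
  msg : A → Q → A → ℕ
  t_comm : ∀ a b q, t a (t b q) = t b (t a q)
  msg_comm : ∀ a b q c, msg a q c + msg b (t a q) c = msg b q c + msg a (t b q) c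

namespace Network

variable {A Q : Type*} [DecidableEq A] (N : Network A Q)

/-- The state obtained after processing the word `w` (letters processed left to right). -/
def tw : List A → Q → Q
  | [], q => q
  | a :: w, q => tw w (N.t a q)

/-- The vector of messages generated while processing the word `w` from state `q`. -/
def nw : List A → Q → A → ℕ
  | [], _, _ => 0
  | a :: w, q, c => N.msg a q c + nw w (N.t a q) c

/-- The configuration transition: `π_w (x.q) = (x + N_w(q) - |w|).t_w(q)`. -/
def piW (w : List A) (c : (A → ℤ) × Q) : (A → ℤ) × Q :=
  (fun a => c.1 a + (nw N w c.2 a : ℤ) - (w.count a : ℤ), tw N w c.2)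

/-- `w` is a legal execution for the configuration `c`: each executed letter has at least
one pending copy at the moment it is executed. -/
def Legal : (A → ℤ) × Q → List A → Prop
  | _, [] => True
  | c, a :: w => 1 ≤ c.1 a ∧ Legal (piW N [a] c) w

/-- A configuration is stable if it has no pending letters. -/
def Stable (c : (A → ℤ) × Q) : Prop := ∀ a, c.1 a ≤ 0

/-- A configuration halts if some legal execution leads from it to a stable configuration. -/
def Halts (c : (A → ℤ) × Q) : Prop := ∃ w : List A, Legal N c w ∧ Stable (piW N w c)

/-- Two configurations are legally related if some configuration is reachable from both of
them by legal executions. -/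
def LegallyRelated (c c' : (A → ℤ) × Q) : Prop :=
  ∃ w w' : List A, Legal N c w ∧ Legal N c' w' ∧ piW N w c = piW N w' c'

end Network

namespace Network

variable {A Q : Type*} [DecidableEq A] (N : Network A Q)

/-- A single legal step: process one letter that has a pending copy. -/
def LegalStep (c c' : (A → ℤ) × Q) : Prop := ∃ a, 1 ≤ c.1 a ∧ piW N [a] c = c'

theorem piW_nil (c : (A → ℤ) × Q) : piW N [] c = c := by
  simp [piW, nw, tw]

theorem piW_cons (a : A) (w : List A) (c : (A → ℤ) × Q) :
    piW N (a :: w) c = piW N w (piW N [a] c) := by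
  refine Prod.ext (funext fun b => ?_) rfl
  simp only [piW, nw, tw, List.count_cons, List.count_nil]
  push_cast
  ring

theorem piW_singleton_comm (a b : A) (c : (A → ℤ) × Q) :
    piW N [a] (piW N [b] c) = piW N [b] (piW N [a] c) := by
  refine Prod.ext (funext fun d => ?_) (N.t_comm a b c.2)
  have h := N.msg_comm a b c.2 d
  simp only [piW, nw, tw]
  push_cast
  linarith

theorem le_piW_singleton {a b : A} (hab : b ≠ a) (c : (A → ℤ) × Q) :
    c.1 a ≤ (piW N [b] c).1 a := by
  simp [piW, List.count_singleton, hab]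

variable {N}

theorem Legal.reflTransGen {w : List A} {c : (A → ℤ) × Q} (h : Legal N c w) :
    Relation.ReflTransGen N.LegalStep c (piW N w c) := by
  induction w generalizing c with
  | nil => rw [piW_nil]
  | cons a w ih =>
    rw [piW_cons]
    exact .head ⟨a, h.1, rfl⟩ (ih h.2)

theorem Stable.eq_of_reflTransGen {c d : (A → ℤ) × Q} (hc : Stable c)
    (h : Relation.ReflTransGen N.LegalStep c d) : c = d := by
  rcases h.cases_head with h | ⟨_, ⟨a, ha, _⟩, _⟩
  · exact h
  · have := hc a
    omega

theorem LegalStep.diamond {c d e : (A → ℤ) × Q} (hd : N.LegalStep c d) (he : N.LegalStep c e) :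
    ∃ f, Relation.ReflGen N.LegalStep d f ∧ Relation.ReflTransGen N.LegalStep e f := by
  obtain ⟨a, ha, rfl⟩ := hd
  obtain ⟨b, hb, rfl⟩ := he
  by_cases hab : a = b
  · subst hab
    exact ⟨_, .refl, .refl⟩
  · exact ⟨_, .single ⟨b, hb.trans (le_piW_singleton N hab c), rfl⟩,
      .single ⟨a, ha.trans (le_piW_singleton N (Ne.symm hab) c), piW_singleton_comm N a b c⟩⟩

theorem Stable.reflTransGen_of_legallyRelated {c s : (A → ℤ) × Q} (hs : Stable s)
    (h : N.LegallyRelated c s) : Relation.ReflTransGen N.LegalStep c s := by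
  obtain ⟨w, v, hw, hv, hwv⟩ := h
  have := hw.reflTransGen
  rwa [hwv, ← hs.eq_of_reflTransGen hv.reflTransGen] at this

theorem Stable.eq_of_legallyRelated {c s s' : (A → ℤ) × Q} (hs : Stable s) (hs' : Stable s')
    (h : N.LegallyRelated c s) (h' : N.LegallyRelated c s') : s = s' := by
  obtain ⟨d, hd, hd'⟩ := Relation.church_rosser (fun _ _ _ => LegalStep.diamond)
    (hs.reflTransGen_of_legallyRelated h) (hs'.reflTransGen_of_legallyRelated h')
  exact (hs.eq_of_reflTransGen hd).trans (hs'.eq_of_reflTransGen hd').symm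

theorem Halts.exists_stable_legallyRelated {c : (A → ℤ) × Q} (h : N.Halts c) :
    ∃ s, Stable s ∧ N.LegallyRelated c s := by
  obtain ⟨w, hw, hs⟩ := h
  exact ⟨_, hs, w, [], hw, trivial, (piW_nil N _).symm⟩

end Network

/-- Let `N` be a finite abelian network in which every configuration halts.  Then (i) every
configuration is legally related to some stable configuration; (ii) any two stable
configurations that are legally related are equal; consequently (iii) every equivalence
class under the legal relation contains exactly one stable configuration. -/
theorem Network.unique_stabilization
    {A Q : Type*} [DecidableEq A] [Fintype A] [Fintype Q] (N : Network A Q)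
    (hhalt : ∀ c : (A → ℤ) × Q, N.Halts c) :
    (∀ c : (A → ℤ) × Q, ∃ c', Network.Stable c' ∧ N.LegallyRelated c c') ∧
    (∀ c c' : (A → ℤ) × Q, Network.Stable c → Network.Stable c' →
      N.LegallyRelated c c' → c = c') ∧
    (∀ c : (A → ℤ) × Q, ∃! c', Network.Stable c' ∧ N.LegallyRelated c c') := by
  refine ⟨fun c => (hhalt c).exists_stable_legallyRelated, fun c c' hc hc' h =>
    hc.eq_of_reflTransGen (hc'.reflTransGen_of_legallyRelated h), fun c => ?_⟩
  obtain ⟨s, hs, hcs⟩ := (hhalt c).exists_stable_legallyRelated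
  exact ⟨s, ⟨hs, hcs⟩, fun s' h' => h'.1.eq_of_legallyRelated hs h'.2 hcs⟩

end AbelianNetworks
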